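/- (Finite-sample form of Theorem 1.) Let d ≥ 1 and N ≥ 1, and let r₁,…,r_N (real data) and s₁,…,s_N (synthetic data) be vectors in ℝ^d (EuclideanSpace ℝ (Fin d)) with Σ_{i=1}^N r_i = Σ_{i=1}^N s_i. Then: (a) w = 0 is a global maximizer of the logistic-regression log-likelihood L(w) = Σ_{i=1}^N log σ(⟨w, r_i⟩) + Σ_{i=1}^N log(1 − σ(⟨w, s_i⟩)), where σ(t) = 1/(1 + exp(−t)); and (b) the C2ST score of the resulting classifier c(x) = σ(⟨0, x⟩), namely 1 − (2·max(AUROC(c), 1/2) − 1) where AUROC(c) = (1/N²) Σ_{i,j} (𝟙[c(r_i) > c(s_j)] + (1/2)·𝟙[c(r_i) = c(s_j)]), equals 1, its maximum possible value. -/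

import Mathlib

open scoped RealInnerProductSpace

/-- The tangent line at `0` bounds the log-sigmoid from above. -/
theorem log_logistic_le (t : ℝ) :
    Real.log (1 / (1 + Real.exp (-t))) ≤ Real.log (1 / 2) + t / 2 := by
  have hexp : Real.exp (-t) = Real.exp (-t / 2) ^ 2 := by
    rw [← Real.exp_nat_mul]
    congr 1
    push_cast
    ring
  have hamgm : 2 * Real.exp (-t / 2) ≤ 1 + Real.exp (-t) := by
    rw [hexp]
    nlinarith [sq_nonneg (1 - Real.exp (-t / 2))]
  have hlog := Real.log_le_log (by positivity) hamgm
  rw [Real.log_mul two_ne_zero (Real.exp_ne_zero _), Real.log_exp] at hlog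
  rw [one_div, one_div, Real.log_inv, Real.log_inv]
  linarith

theorem one_sub_logistic (t : ℝ) :
    1 - 1 / (1 + Real.exp (-t)) = 1 / (1 + Real.exp t) := by
  rw [Real.exp_neg]
  have := Real.exp_pos t
  field_simp
  ring

theorem log_one_sub_logistic_le (t : ℝ) :
    Real.log (1 - 1 / (1 + Real.exp (-t))) ≤ Real.log (1 / 2) - t / 2 := by
  have h := log_logistic_le (-t)
  rw [neg_neg] at h
  rw [one_sub_logistic]
  linarith

/-- Finite-sample form of Theorem 1: if the real data `r` and synthetic data `s` have
equal sums, then (a) `w = 0` is a global maximizer of the logistic-regression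
log-likelihood, and (b) the C2ST score `1 - (2 * max (AUROC c) (1/2) - 1)` of the
resulting classifier `c x = σ ⟪0, x⟫` equals `1`, its maximum possible value. -/
theorem c2st_of_mle_logistic_regressor_eq_one_of_equal_means
    (d N : ℕ) (hd : 1 ≤ d) (hN : 1 ≤ N)
    (r s : Fin N → EuclideanSpace ℝ (Fin d))
    (hmeans : (∑ i, r i) = ∑ i, s i) :
    (∀ w : EuclideanSpace ℝ (Fin d),
      (∑ i, Real.log (1 / (1 + Real.exp (-⟪w, r i⟫)))) +
        (∑ i, Real.log (1 - 1 / (1 + Real.exp (-⟪w, s i⟫)))) ≤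
      (∑ i, Real.log (1 / (1 + Real.exp (-⟪(0 : EuclideanSpace ℝ (Fin d)), r i⟫)))) +
        (∑ i, Real.log (1 - 1 / (1 + Real.exp (-⟪(0 : EuclideanSpace ℝ (Fin d)), s i⟫))))) ∧
    (let c : EuclideanSpace ℝ (Fin d) → ℝ :=
      fun x => 1 / (1 + Real.exp (-⟪(0 : EuclideanSpace ℝ (Fin d)), x⟫))
     let auroc : ℝ :=
      (1 / (N : ℝ) ^ 2) *
        ∑ i, ∑ j,
          ((if c (r i) > c (s j) then (1 : ℝ) else 0) +
            (1 / 2) * (if c (r i) = c (s j) then (1 : ℝ) else 0))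
     1 - (2 * max auroc (1 / 2) - 1) = 1) := by
  refine ⟨fun w => ?_, ?_⟩
  · have hr : ∑ i, Real.log (1 / (1 + Real.exp (-⟪w, r i⟫))) ≤
        ∑ i, (Real.log (1 / 2) + ⟪w, r i⟫ / 2) :=
      Finset.sum_le_sum fun i _ => log_logistic_le _
    have hs : ∑ i, Real.log (1 - 1 / (1 + Real.exp (-⟪w, s i⟫))) ≤
        ∑ i, (Real.log (1 / 2) - ⟪w, s i⟫ / 2) :=
      Finset.sum_le_sum fun i _ => log_one_sub_logistic_le _
    have hinner : ∑ i, ⟪w, r i⟫ = ∑ i, ⟪w, s i⟫ := by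
      rw [← inner_sum, ← inner_sum, hmeans]
    rw [Finset.sum_add_distrib, ← Finset.sum_div] at hr
    rw [Finset.sum_sub_distrib, ← Finset.sum_div] at hs
    have hhalf : (1 : ℝ) / (1 + 1) = 1 / 2 := by norm_num
    have hhalf' : (1 : ℝ) - 1 / 2 = 1 / 2 := by norm_num
    simp only [inner_zero_left, neg_zero, Real.exp_zero, hhalf, hhalf']
    linarith
  · have hN0 : (N : ℝ) ≠ 0 := by
      exact_mod_cast Nat.one_le_iff_ne_zero.mp hN
    have hauroc : 1 / (N : ℝ) ^ 2 * ((N : ℝ) * ((N : ℝ) * (1 / 2))) = 1 / 2 := by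
      field_simp
    simp only [inner_zero_left, gt_iff_lt, lt_irrefl, if_true, if_false, zero_add, mul_one,
      Finset.sum_const, Finset.card_univ, Fintype.card_fin, nsmul_eq_mul, hauroc, max_self]
    norm_num
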